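/- arXiv:1503.01191 — 3 statements merged into one kernel-verified Lean document; each statement's English description precedes it below -/
import Mathlib

section
/- Let T₀ > 0 and let R_C1, R_C2, R_C3, R_M1, R_M3 be real numbers with 0 < R_M3 ≤ R_M1, R_C1 < R_C2, R_C3 < R_C2, and R_M1·(R_C2 − R_C3) > R_M3·(R_C2 − R_C1). Define the feasible set S = {(t₁,t₃) ∈ ℝ² : t₁ ≥ 0, t₃ ≥ 0, t₁ + t₃ ≤ T₀, t₁·R_M1 + t₃·R_M3 ≥ T₀·R_M3} and the utility U(t₁,t₃) = t₁·R_C1 + (T₀ − t₁ − t₃)·R_C2 − (T₀ − t₃)·R_C3. Then the point (t₁*, t₃*) = (T₀·R_M3/R_M1, 0) belongs to S, satisfies the individual-rationality constraint with equality t₁*·R_M1 + t₃*·R_M3 = T₀·R_M3, and is the unique maximizer of U on S: every (t₁,t₃) ∈ S with (t₁,t₃) ≠ (t₁*,t₃*) satisfies U(t₁,t₃) < U(t₁*,t₃*). -/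
/-- Lemma 1 (time-allocation part, complete CSI): the contract point
`(t₁*, t₃*) = (T₀·R_M3/R_M1, 0)` is feasible, binds the individual-rationality
constraint, and is the unique maximizer of the principal's rate-based utility. -/
theorem contract_time_allocation_optimal
    (T0 RC1 RC2 RC3 RM1 RM3 : ℝ)
    (hT0 : 0 < T0) (hRM3 : 0 < RM3) (hRM : RM3 ≤ RM1)
    (h12 : RC1 < RC2) (h32 : RC3 < RC2)
    (hkey : RM1 * (RC2 - RC3) > RM3 * (RC2 - RC1))
    (S : Set (ℝ × ℝ))
    (hS : S = {p : ℝ × ℝ | 0 ≤ p.1 ∧ 0 ≤ p.2 ∧ p.1 + p.2 ≤ T0 ∧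
      p.1 * RM1 + p.2 * RM3 ≥ T0 * RM3})
    (U : ℝ × ℝ → ℝ)
    (hU : ∀ p : ℝ × ℝ, U p = p.1 * RC1 + (T0 - p.1 - p.2) * RC2 - (T0 - p.2) * RC3) :
    (T0 * RM3 / RM1, (0 : ℝ)) ∈ S ∧
    (T0 * RM3 / RM1) * RM1 + 0 * RM3 = T0 * RM3 ∧
    ∀ p ∈ S, p ≠ (T0 * RM3 / RM1, (0 : ℝ)) → U p < U (T0 * RM3 / RM1, 0) := by
  have hM1 : 0 < RM1 := hRM3.trans_le hRM
  have hbind : T0 * RM3 / RM1 * RM1 = T0 * RM3 := div_mul_cancel₀ _ hM1.ne'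
  subst hS
  refine ⟨⟨by positivity, le_rfl, ?_, ?_⟩, ?_, ?_⟩
  · rw [add_zero, div_le_iff₀ hM1]
    exact mul_le_mul_of_nonneg_left hRM hT0.le
  · simp [hbind]
  · rw [hbind]
    ring
  · rintro ⟨t1, t3⟩ ⟨-, h3, -, hIR⟩ hne
    simp only [ge_iff_le] at h3 hIR
    rw [hU, hU]
    dsimp only
    generalize T0 * RM3 / RM1 = s at hbind hne ⊢
    have key : 0 < RM1 * ((RC2 - RC1) * (t1 - s) + (RC2 - RC3) * t3) := by
      have hsplit : RM1 * ((RC2 - RC1) * (t1 - s) + (RC2 - RC3) * t3) =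
          (RC2 - RC1) * (t1 * RM1 + t3 * RM3 - T0 * RM3) +
            t3 * (RM1 * (RC2 - RC3) - RM3 * (RC2 - RC1)) := by
        rw [← hbind]
        ring
      rw [hsplit]
      have hcost : 0 < RC2 - RC1 := sub_pos.2 h12
      have hgain : 0 < RM1 * (RC2 - RC3) - RM3 * (RC2 - RC1) := sub_pos.2 hkey
      rcases h3.eq_or_lt with h0 | h0
      · subst h0
        have hslack : 0 < t1 * RM1 + 0 * RM3 - T0 * RM3 := by
          refine lt_of_le_of_ne (sub_nonneg.2 hIR) fun h => hne ?_
          have hts : t1 = s := mul_right_cancel₀ hM1.ne' (by linarith)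
          rw [hts]
        exact add_pos_of_pos_of_nonneg (mul_pos hcost hslack) (zero_mul _).ge
      · exact add_pos_of_nonneg_of_pos (mul_nonneg hcost.le (sub_nonneg.2 hIR))
          (mul_pos h0 hgain)
    have hdiff := pos_of_mul_pos_right key hM1.le
    linarith
end

section
/- Fix natural numbers M ≥ 1 and K with K > M + 1, and positive reals σ² , ε₁, υ, P_max, T₀, and reals R_C2, R_C3, R_M3 with R_M3 > 0. For P_C1, P_M1 ≥ 0 define R_C1(P_C1) = M·log(1 + P_C1/σ²) and R_M1(P_M1) = log(1 + P_M1/σ²). Consider maximizing U(t₁,t₃,P_C1,P_M1) = t₁·R_C1(P_C1) + (T₀ − t₁ − t₃)·R_C2 − (T₀ − t₃)·R_C3 subject to t₁ ≥ 0, t₃ ≥ 0, t₁ + t₃ ≤ T₀, the IR constraint t₁·R_M1(P_M1) + t₃·R_M3 ≥ T₀·R_M3, P_C1 ≥ 0, P_M1 ≥ 0, and the power constraint P_C1/((K−M−1)·ε₁) + P_M1/((K−M−1)·υ) ≤ P_max. If (t₁*, t₃*, P_C1*, P_M1*) is a maximizer of this problem with t₁* > 0, then the power constraint is tight: P_C1*/((K−M−1)·ε₁)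 + P_M1*/((K−M−1)·υ) = P_max. -/
/-- Lemma 1 (power-allocation part, complete CSI): at any maximizer of the
principal's rate-based utility with `t₁* > 0`, the expected total transmit
power constraint is tight. -/
theorem contract_power_constraint_tight
    (M K : ℕ) (hM : 1 ≤ M) (hK : M + 1 < K)
    (σ2 ε1 υ Pmax T0 : ℝ) (hσ2 : 0 < σ2) (hε1 : 0 < ε1) (hυ : 0 < υ)
    (hPmax : 0 < Pmax) (hT0 : 0 < T0)
    (RC2 RC3 RM3 : ℝ) (hRM3 : 0 < RM3)
    (RC1 RM1 : ℝ → ℝ)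
    (hRC1 : ∀ P, RC1 P = M * Real.log (1 + P / σ2))
    (hRM1 : ∀ P, RM1 P = Real.log (1 + P / σ2))
    (U : ℝ → ℝ → ℝ → ℝ → ℝ)
    (hUdef : ∀ t1 t3 PC1 PM1, U t1 t3 PC1 PM1 =
      t1 * RC1 PC1 + (T0 - t1 - t3) * RC2 - (T0 - t3) * RC3)
    (feasible : ℝ → ℝ → ℝ → ℝ → Prop)
    (hfeas : ∀ t1 t3 PC1 PM1, feasible t1 t3 PC1 PM1 ↔
      0 ≤ t1 ∧ 0 ≤ t3 ∧ t1 + t3 ≤ T0 ∧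
      t1 * RM1 PM1 + t3 * RM3 ≥ T0 * RM3 ∧
      0 ≤ PC1 ∧ 0 ≤ PM1 ∧
      PC1 / ((K - M - 1 : ℝ) * ε1) + PM1 / ((K - M - 1 : ℝ) * υ) ≤ Pmax)
    (t1s t3s PC1s PM1s : ℝ)
    (hfeass : feasible t1s t3s PC1s PM1s)
    (hmax : ∀ t1 t3 PC1 PM1, feasible t1 t3 PC1 PM1 →
      U t1 t3 PC1 PM1 ≤ U t1s t3s PC1s PM1s)
    (ht1pos : 0 < t1s) :
    PC1s / ((K - M - 1 : ℝ) * ε1) + PM1s / ((K - M - 1 : ℝ) * υ) = Pmax := by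
  obtain ⟨h1, h3, hT, hIR, hC, hM1, hP⟩ := (hfeas _ _ _ _).1 hfeass
  have hKM : (0 : ℝ) < K - M - 1 := by
    have h : (M : ℝ) + 1 < K := by exact_mod_cast hK
    linarith
  have hMpos : (0 : ℝ) < M := by exact_mod_cast hM
  have hc : 0 < (K - M - 1 : ℝ) * ε1 := mul_pos hKM hε1
  by_contra hne
  have hlt := lt_of_le_of_ne hP hne
  set c := (K - M - 1 : ℝ) * ε1
  set q := PM1s / ((K - M - 1 : ℝ) * υ)
  -- Spend all the remaining power on the RUEs.
  have hPC : PC1s < (Pmax - q) * c := (div_lt_iff₀ hc).1 (by linarith)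
  have hU := hmax t1s t3s ((Pmax - q) * c) PM1s ((hfeas _ _ _ _).2
    ⟨h1, h3, hT, hIR, hC.trans hPC.le, hM1, by
      rw [mul_div_cancel_right₀ _ hc.ne']; linarith⟩)
  have hlog : Real.log (1 + PC1s / σ2) < Real.log (1 + (Pmax - q) * c / σ2) :=
    Real.log_lt_log (by positivity) (by gcongr)
  have hrate := mul_lt_mul_of_pos_left (mul_lt_mul_of_pos_left hlog hMpos) ht1pos
  rw [hUdef, hUdef, hRC1, hRC1] at hU
  linarith
end

section
/- Let L ≥ 1, T₀ > 0, R_M1 > 0, and reals R_C1, R_C2, R_C3 with R_C1 ≤ R_C2 and R_C3 < R_C2. Let q : {1,…,L} → ℝ be strictly positive and r : {1,…,L} → ℝ be monotone nondecreasing with r(l) > 0 for all l, and set u = T₀·r(L). For t₃ : {1,…,L} → ℝ define t̃₁(1) = (u − t₃(1)·r(1))/R_M1 and for l ≥ 2, t̃₁(l) = (u − t₃(1)·r(1) + Σ_{i=2}^{l} r(i)·(t₃(i−1) − t₃(i)))/R_M1, and define U*(t₃) = (R_C1 − R_C2)·Σ_{l=1}^{L} q(l)·t̃₁(l) − (R_C2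 − R_C3)·Σ_{l=1}^{L} q(l)·t₃(l) + T₀·(R_C2 − R_C3). If R_M1·(R_C2 − R_C3) > r(L)·(R_C2 − R_C1), then for every t₃ satisfying 0 ≤ t₃(1) ≤ t₃(2) ≤ … ≤ t₃(L) with t₃ not identically zero, U*(t₃) < U*(0); that is, the zero allocation t₃(l) = 0 for all l is the unique maximizer of U* over the monotone cone. -/
open Finset

/-- Abel-type bound: the increments of a monotone nonnegative sequence, weighted by coefficients
that are at most `c`, sum to at most `c` times the last term. -/
lemma neg_mul_le_sum_weighted_decrements {L : ℕ} {c : ℝ} {r t : ℕ → ℝ}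
    (hr : ∀ l, 1 ≤ l → l ≤ L → r l ≤ c) (h0 : 0 ≤ t 1)
    (ht : ∀ l, 1 ≤ l → l < L → t l ≤ t (l + 1)) {l : ℕ} (hl : 1 ≤ l) (hlL : l ≤ L) :
    -(c * t l) ≤ -(t 1 * r 1) + ∑ i ∈ Finset.Icc 2 l, r i * (t (i - 1) - t i) := by
  induction l, hl using Nat.le_induction with
  | base =>
    simp only [Finset.Icc_eq_empty_of_lt one_lt_two, Finset.sum_empty]
    nlinarith [hr 1 le_rfl hlL]
  | succ n hn ih =>
    rw [Finset.sum_Icc_succ_top (by lia), Nat.add_sub_cancel]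
    nlinarith [ih (by lia), mul_nonneg (sub_nonneg.2 (hr (n + 1) (by lia) hlL))
      (sub_nonneg.2 (ht n hn (by lia)))]

/-- A sequence that is monotone on `1, …, L` and nonnegative at `1` is nonnegative there. -/
lemma nonneg_of_nonneg_one_of_le_succ {L : ℕ} {t : ℕ → ℝ} (h0 : 0 ≤ t 1)
    (ht : ∀ l, 1 ≤ l → l < L → t l ≤ t (l + 1)) {l : ℕ} (hl : 1 ≤ l) (hlL : l ≤ L) :
    0 ≤ t l := by
  induction l, hl using Nat.le_induction with
  | base => exact h0
  | succ n hn ih => exact (ih (by lia)).trans (ht n hn (by lia))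

/-- Lemma 3, first case (imperfect CSI, large `K`): when
`R_M1(R_C2 − R_C3) > r(L)(R_C2 − R_C1)`, the zero Phase-III allocation
`t₃ ≡ 0` is the unique maximizer of the principal's expected utility `U*`
over the monotone cone `0 ≤ t₃¹ ≤ … ≤ t₃^L`. -/
theorem optimal_contract_zero_phase_three
    (L : ℕ) (hL : 1 ≤ L) (T0 RM1 RC1 RC2 RC3 : ℝ)
    (hT0 : 0 < T0) (hRM1 : 0 < RM1) (h12 : RC1 ≤ RC2) (h32 : RC3 < RC2)
    (q r : ℕ → ℝ)
    (hq : ∀ l ∈ Finset.Icc 1 L, 0 < q l)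
    (hrmono : ∀ l l' : ℕ, 1 ≤ l → l ≤ l' → l' ≤ L → r l ≤ r l')
    (hrpos : ∀ l ∈ Finset.Icc 1 L, 0 < r l)
    (u : ℝ) (hu : u = T0 * r L)
    (tt1 : (ℕ → ℝ) → ℕ → ℝ)
    (htt1 : ∀ (t3 : ℕ → ℝ) (l : ℕ), tt1 t3 l =
      (u - t3 1 * r 1 + ∑ i ∈ Finset.Icc 2 l, r i * (t3 (i - 1) - t3 i)) / RM1)
    (Ustar : (ℕ → ℝ) → ℝ)
    (hUstar : ∀ t3 : ℕ → ℝ, Ustar t3 =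
      (RC1 - RC2) * ∑ l ∈ Finset.Icc 1 L, q l * tt1 t3 l
        - (RC2 - RC3) * ∑ l ∈ Finset.Icc 1 L, q l * t3 l
        + T0 * (RC2 - RC3))
    (hkey : RM1 * (RC2 - RC3) > r L * (RC2 - RC1)) :
    ∀ t3 : ℕ → ℝ, 0 ≤ t3 1 →
      (∀ l : ℕ, 1 ≤ l → l < L → t3 l ≤ t3 (l + 1)) →
      (∃ l ∈ Finset.Icc 1 L, t3 l ≠ 0) →
      Ustar t3 < Ustar (fun _ => 0) := by
  intro t h0 ht ⟨m, hm, hmt⟩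
  have hnonneg : ∀ l ∈ Finset.Icc 1 L, 0 ≤ t l := fun l hl =>
    nonneg_of_nonneg_one_of_le_succ h0 ht (Finset.mem_Icc.1 hl).1 (Finset.mem_Icc.1 hl).2
  have hzero : ∀ l, tt1 (fun _ => 0) l = u / RM1 := fun l => by simp [htt1]
  set d : ℝ := RC2 - RC3 - r L * (RC2 - RC1) / RM1 with hd
  have hdpos : 0 < d := by
    rw [hd, sub_pos, div_lt_iff₀ hRM1]
    linarith
  have hterm : ∀ l ∈ Finset.Icc 1 L,
      (RC1 - RC2) * tt1 t l - (RC2 - RC3) * t l ≤ (RC1 - RC2) * (u / RM1) - d * t l := by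
    intro l hl
    obtain ⟨hl1, hlL⟩ := Finset.mem_Icc.1 hl
    have hbound := neg_mul_le_sum_weighted_decrements
      (fun l h1 h2 => hrmono l L h1 h2 le_rfl) h0 ht hl1 hlL
    have htt : (u - r L * t l) / RM1 ≤ tt1 t l := by
      rw [htt1]
      gcongr
      linarith
    have hmul := mul_le_mul_of_nonpos_left htt (sub_nonpos.2 h12)
    have hexpand : (RC1 - RC2) * ((u - r L * t l) / RM1) - (RC2 - RC3) * t l =
        (RC1 - RC2) * (u / RM1) - d * t l := by
      rw [hd]
      ring
    linarith
  have hsum : ∑ l ∈ Finset.Icc 1 L, q l * ((RC1 - RC2) * tt1 t l - (RC2 - RC3) * t l) <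
      ∑ l ∈ Finset.Icc 1 L, q l * ((RC1 - RC2) * (u / RM1)) := by
    refine Finset.sum_lt_sum (fun l hl => ?_) ⟨m, hm, ?_⟩
    · refine mul_le_mul_of_nonneg_left ?_ (hq l hl).le
      linarith [hterm l hl, mul_nonneg hdpos.le (hnonneg l hl)]
    · refine mul_lt_mul_of_pos_left ?_ (hq m hm)
      linarith [hterm m hm, mul_pos hdpos ((hnonneg m hm).lt_of_ne' hmt)]
  have hleft : (RC1 - RC2) * ∑ l ∈ Finset.Icc 1 L, q l * tt1 t l
      - (RC2 - RC3) * ∑ l ∈ Finset.Icc 1 L, q l * t l =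
      ∑ l ∈ Finset.Icc 1 L, q l * ((RC1 - RC2) * tt1 t l - (RC2 - RC3) * t l) := by
    rw [Finset.mul_sum, Finset.mul_sum, ← Finset.sum_sub_distrib]
    exact Finset.sum_congr rfl fun _ _ => by ring
  have hright : (RC1 - RC2) * ∑ l ∈ Finset.Icc 1 L, q l * (u / RM1) =
      ∑ l ∈ Finset.Icc 1 L, q l * ((RC1 - RC2) * (u / RM1)) := by
    rw [Finset.mul_sum]
    exact Finset.sum_congr rfl fun _ _ => by ring
  simp only [hUstar, hzero, mul_zero, Finset.sum_const_zero, sub_zero]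
  linarith
end
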